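/- Let r < K_P ≤ N be positive integers, K = K_P + K_S with K_S ≥ N, and let γ_1 ≥ … ≥ γ_N ≥ 0 with γ_i > 0 for i ≤ K_P and γ_i = 0 for i > K_P. Assume (K_P − r)·K_S > (N − K_P)·K_P. Then the equation Σ_{i=r+1}^{K_P} K/(γγ_i + 1) = (K_P − r)K_S − (N − K_P)K_P has a unique positive solution γ̂, and γ̂ ≥ (K_P/K_S)·(1/γ_r). -/

import Mathlib

open Finset

theorem strictAntiOn_sum_div_mul_add_one {ι : Type*} {s : Finset ι} (hs : s.Nonempty)
    {c : ℝ} (hc : 0 < c) {g : ι → ℝ} (hg : ∀ i ∈ s, 0 < g i) :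
    StrictAntiOn (fun x : ℝ => ∑ i ∈ s, c / (x * g i + 1)) (Set.Ici 0) := by
  intro x hx y _ hxy
  refine Finset.sum_lt_sum_of_nonempty hs fun i hi => ?_
  have hgi := hg i hi
  have hx' : 0 ≤ x := hx
  exact div_lt_div_of_pos_left hc (by positivity) (by gcongr)

theorem tendsto_sum_div_mul_add_one_atTop {ι : Type*} {s : Finset ι}
    (c : ℝ) {g : ι → ℝ} (hg : ∀ i ∈ s, 0 < g i) :
    Filter.Tendsto (fun x : ℝ => ∑ i ∈ s, c / (x * g i + 1)) Filter.atTop (nhds 0) := by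
  rw [← Finset.sum_const_zero (s := s)]
  refine tendsto_finsetSum s fun i hi => Filter.Tendsto.const_div_atTop ?_ c
  exact Filter.tendsto_atTop_add_const_right _ _
    (Filter.tendsto_id.atTop_mul_const (hg i hi))

theorem continuousOn_sum_div_mul_add_one {ι : Type*} {s : Finset ι}
    (c : ℝ) {g : ι → ℝ} (hg : ∀ i ∈ s, 0 < g i) :
    ContinuousOn (fun x : ℝ => ∑ i ∈ s, c / (x * g i + 1)) (Set.Ici 0) := by
  refine continuousOn_finsetSum s fun i hi => ContinuousOn.div (by fun_prop) (by fun_prop) ?_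
  intro x hx
  have hgi := hg i hi
  have hx' : 0 ≤ x := hx
  positivity

/-- A positive level not exceeding the value at `a ≥ 0` is attained at or after `a`. -/
theorem exists_sum_div_mul_add_one_eq {ι : Type*} {s : Finset ι}
    {c a t : ℝ} {g : ι → ℝ} (hg : ∀ i ∈ s, 0 < g i) (ha : 0 ≤ a) (ht : 0 < t)
    (hat : t ≤ ∑ i ∈ s, c / (a * g i + 1)) :
    ∃ x, a ≤ x ∧ ∑ i ∈ s, c / (x * g i + 1) = t := by
  obtain ⟨b, hbt, hab⟩ := (((tendsto_sum_div_mul_add_one_atTop c hg).eventually_lt_const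
    ht).and (Filter.eventually_ge_atTop a)).exists
  have hcont := (continuousOn_sum_div_mul_add_one c hg).mono
    (fun x (hx : x ∈ Set.Icc a b) => Set.mem_Ici.2 (ha.trans hx.1))
  obtain ⟨x, hx, hxt⟩ := intermediate_value_Icc' hab hcont ⟨hbt.le, hat⟩
  exact ⟨x, hx.1, hxt⟩

/-- Theorem 4 of the paper (stationarity equation): with `r < K_P ≤ N`, `K_S ≥ N`,
`K = K_P + K_S`, eigenvalues `γ_1 ≥ … ≥ γ_N ≥ 0` positive up to index `K_P` and zero
after, and `(K_P − r)K_S > (N − K_P)K_P`, the equation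
`Σ_{i=r+1}^{K_P} K/(γγ_i + 1) = (K_P − r)K_S − (N − K_P)K_P` has a unique positive
solution `γ₀`, and `γ₀ ≥ (K_P/K_S)(1/γ_r)`. -/
theorem stmt15 (N K_P K_S r K : ℕ) (hK : K = K_P + K_S) (hr : 0 < r)
    (hrKP : r < K_P) (hKPN : K_P ≤ N) (hKS : N ≤ K_S)
    (g : ℕ → ℝ) (hanti : AntitoneOn g (Set.Icc 1 N))
    (hnn : ∀ i, 0 ≤ g i)
    (hpos : ∀ i, 1 ≤ i → i ≤ K_P → 0 < g i) (hzero : ∀ i, K_P < i → g i = 0)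
    (hcond : ((N : ℝ) - K_P) * K_P < ((K_P : ℝ) - r) * K_S) :
    ∃ γ₀ : ℝ, 0 < γ₀ ∧
      (∑ i ∈ Finset.Icc (r + 1) K_P, (K : ℝ) / (γ₀ * g i + 1)
        = ((K_P : ℝ) - r) * K_S - ((N : ℝ) - K_P) * K_P) ∧
      (∀ γ' : ℝ, 0 < γ' →
        (∑ i ∈ Finset.Icc (r + 1) K_P, (K : ℝ) / (γ' * g i + 1)
          = ((K_P : ℝ) - r) * K_S - ((N : ℝ) - K_P) * K_P) → γ' = γ₀) ∧
      (K_P : ℝ) / K_S * (1 / g r) ≤ γ₀ := by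
  have hP : (0 : ℝ) < K_P := by exact_mod_cast hr.trans hrKP
  have hS : (0 : ℝ) < K_S := by exact_mod_cast (hr.trans hrKP).trans_le (hKPN.trans hKS)
  have hKpos : (0 : ℝ) < K := by rw [hK]; push_cast; positivity
  have hNP : (K_P : ℝ) ≤ N := by exact_mod_cast hKPN
  have hgr : 0 < g r := hpos r hr hrKP.le
  have hg : ∀ i ∈ Finset.Icc (r + 1) K_P, 0 < g i := fun i hi => by
    rw [Finset.mem_Icc] at hi
    exact hpos i (by omega) hi.2
  have ha : 0 < (K_P : ℝ) / K_S * (1 / g r) := by positivity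
  have hterm : ∀ i ∈ Finset.Icc (r + 1) K_P,
      (K_S : ℝ) ≤ (K : ℝ) / ((K_P : ℝ) / K_S * (1 / g r) * g i + 1) := fun i hi => by
    have hgi := hg i hi
    rw [Finset.mem_Icc] at hi
    have hle : g i ≤ g r := hanti ⟨hr, by omega⟩ ⟨by omega, by omega⟩ (by omega)
    rw [le_div_iff₀ (by positivity)]
    calc (K_S : ℝ) * ((K_P : ℝ) / K_S * (1 / g r) * g i + 1)
        ≤ (K_S : ℝ) * ((K_P : ℝ) / K_S * (1 / g r) * g r + 1) := by gcongr
      _ = K := by rw [hK]; push_cast; field_simp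
  have hlow := Finset.card_nsmul_le_sum _ _ _ hterm
  have hcard : (((Finset.Icc (r + 1) K_P).card : ℕ) : ℝ) = (K_P : ℝ) - r := by
    rw [Nat.card_Icc, Nat.add_sub_add_right, Nat.cast_sub hrKP.le]
  rw [nsmul_eq_mul, hcard] at hlow
  have hdef : 0 ≤ ((N : ℝ) - K_P) * K_P := mul_nonneg (sub_nonneg.2 hNP) hP.le
  obtain ⟨x, hax, hx⟩ := exists_sum_div_mul_add_one_eq hg ha.le (sub_pos.2 hcond)
    ((sub_le_self _ hdef).trans hlow)
  have hx0 := ha.trans_le hax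
  refine ⟨x, hx0, hx, fun y hy hyt => ?_, hax⟩
  exact (strictAntiOn_sum_div_mul_add_one (Finset.nonempty_Icc.2 hrKP) hKpos hg).injOn
    (Set.mem_Ici.2 hy.le) (Set.mem_Ici.2 hx0.le) (hyt.trans hx.symm)
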